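/- Consider all simplicial complexes K on the 4-element set [4] = {1,2,3,4} with K ≠ 2^{[4]}, and for each such K form its Bier sphere Bier(K), a simplicial complex on the 8-element set [4] ⊔ [4]'. Then, up to combinatorial equivalence (bijections of the 8-element ground sets mapping faces to faces in both directions), the resulting Bier spheres fall into exactly 13 equivalence classes. -/

import Mathlib

/-- A simplicial complex on a ground type `V`: a collection of finite subsets of `V`
containing the empty set and closed under taking subsets. -/
def IsSimplicialComplex {V : Type*} (K : Set (Finset V)) : Prop :=
  ∅ ∈ K ∧ ∀ s ∈ K, ∀ t ⊆ s, t ∈ K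

/-- A minimal non-face of `K`: not a face, but all proper subsets are faces. -/
def IsMinNonFace {V : Type*} (K : Set (Finset V)) (s : Finset V) : Prop :=
  s ∉ K ∧ ∀ t ⊂ s, t ∈ K

/-- The Alexander dual of `K`, with the primed copy `V'` identified with `V`:
faces are those `τ` with `V \ τ` not a face of `K`. -/
def alexDual {V : Type*} [Fintype V] [DecidableEq V] (K : Set (Finset V)) :
    Set (Finset V) :=
  {τ | Finset.univ \ τ ∉ K}

/-- The Bier sphere of `K`: the deleted join of `K` and its Alexander dual, a complex on
`V ⊕ V` (left summand = `V`, right summand = the primed copy `V'`). -/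
def bier {V : Type*} [Fintype V] [DecidableEq V] (K : Set (Finset V)) :
    Set (Finset (V ⊕ V)) :=
  {ρ | ∃ σ τ : Finset V, σ ∈ K ∧ τ ∈ alexDual K ∧ Disjoint σ τ ∧
    ρ = σ.image Sum.inl ∪ τ.image Sum.inr}

/-- Combinatorial equivalence of two simplicial complexes on the same ground type:
a bijection of the ground sets mapping faces to faces in both directions. -/
def CombEquiv {α : Type*} [DecidableEq α] (L₁ L₂ : Set (Finset α)) : Prop :=
  ∃ e : α ≃ α, ∀ s : Finset α, s ∈ L₁ ↔ s.image e ∈ L₂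

/-! ### Membership in Bier spheres and natural equivalences -/

section General

variable {V : Type*} [Fintype V] [DecidableEq V]

theorem mem_bier_iff (K : Set (Finset V)) (ρ : Finset (V ⊕ V)) :
    ρ ∈ bier K ↔
      ρ.toLeft ∈ K ∧ Finset.univ \ ρ.toRight ∉ K ∧ Disjoint ρ.toLeft ρ.toRight := by
  constructor
  · rintro ⟨σ, τ, hσ, hτ, hd, rfl⟩
    have hl : (σ.image Sum.inl ∪ τ.image (Sum.inr : V → V ⊕ V)).toLeft = σ := by
      ext; simp
    have hr : (σ.image (Sum.inl : V → V ⊕ V) ∪ τ.image Sum.inr).toRight = τ := by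
      ext; simp
    rw [hl, hr]
    exact ⟨hσ, hτ, hd⟩
  · rintro ⟨hσ, hτ, hd⟩
    refine ⟨ρ.toLeft, ρ.toRight, hσ, hτ, hd, ?_⟩
    ext x
    cases x <;> simp

instance decidableMemBier (K : Set (Finset V)) [DecidablePred (· ∈ K)] :
    DecidablePred (· ∈ bier K) := fun ρ =>
  decidable_of_iff _ (mem_bier_iff K ρ).symm

theorem CombEquiv.trans {α : Type*} [DecidableEq α] {L₁ L₂ L₃ : Set (Finset α)}
    (h₁ : CombEquiv L₁ L₂) (h₂ : CombEquiv L₂ L₃) : CombEquiv L₁ L₃ := by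
  obtain ⟨e, he⟩ := h₁
  obtain ⟨f, hf⟩ := h₂
  refine ⟨e.trans f, fun s => ?_⟩
  rw [he, hf, Finset.image_image]
  rfl

theorem combEquiv_bier_of_combEquiv {K L : Set (Finset V)} (h : CombEquiv K L) :
    CombEquiv (bier K) (bier L) := by
  obtain ⟨e, he⟩ := h
  refine ⟨Equiv.sumCongr e e, fun ρ => ?_⟩
  have hl : (ρ.image (Equiv.sumCongr e e)).toLeft = ρ.toLeft.image e := by
    ext; simp
  have hr : (ρ.image (Equiv.sumCongr e e)).toRight = ρ.toRight.image e := by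
    ext; simp
  have hc : Finset.univ \ ρ.toRight.image e = (Finset.univ \ ρ.toRight).image e := by
    rw [Finset.image_sdiff _ _ e.injective, Finset.image_univ_equiv]
  rw [mem_bier_iff, mem_bier_iff, hl, hr, hc, ← he, ← he,
    Finset.disjoint_image e.injective]

theorem combEquiv_bier_alexDual (K : Set (Finset V)) :
    CombEquiv (bier (alexDual K)) (bier K) := by
  refine ⟨Equiv.sumComm V V, fun ρ => ?_⟩
  have hl : (ρ.image (Equiv.sumComm V V)).toLeft = ρ.toRight := by
    ext; simp
  have hr : (ρ.image (Equiv.sumComm V V)).toRight = ρ.toLeft := by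
    ext; simp
  rw [mem_bier_iff, mem_bier_iff, hl, hr, disjoint_comm]
  simp only [alexDual, Set.mem_ofPred_eq, not_not, sdiff_sdiff_right_self, Finset.inf_eq_inter,
    Finset.univ_inter]
  tauto

end General

/-! ### The degree sequence -/

section DegreeSequence

variable {α : Type*} [Fintype α] [DecidableEq α]

/-- The number of edges of `L` at the vertex `v`. -/
def edgeDegree (L : Set (Finset α)) [DecidablePred (· ∈ L)] (v : α) : ℕ :=
  (Finset.univ.filter fun w => w ≠ v ∧ ({v, w} : Finset α) ∈ L).card

/-- The multiset of the edge degrees of all elements of the ground set. -/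
def degreeSequence (L : Set (Finset α)) [DecidablePred (· ∈ L)] : Multiset ℕ :=
  Finset.univ.val.map (edgeDegree L)

theorem CombEquiv.degreeSequence_eq {L₁ L₂ : Set (Finset α)} [DecidablePred (· ∈ L₁)]
    [DecidablePred (· ∈ L₂)] (h : CombEquiv L₁ L₂) :
    degreeSequence L₁ = degreeSequence L₂ := by
  obtain ⟨e, he⟩ := h
  have hdeg : ∀ v, edgeDegree L₁ v = edgeDegree L₂ (e v) := fun v => by
    refine Finset.card_equiv e fun w => ?_
    simp [he, Finset.image_insert]
  have huniv : (Finset.univ : Finset α).val.map e = Finset.univ.val := by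
    simp
  unfold degreeSequence
  conv_rhs => rw [← huniv, Multiset.map_map]
  exact Multiset.map_congr rfl fun v _ => hdeg v

end DegreeSequence

/-! ### Representatives -/

section Representatives

/-- The simplicial complex generated by the sets in `F`. -/
def generatedComplex {V : Type*} (F : List (Finset V)) : Set (Finset V) :=
  {s | ∃ t ∈ F, s ⊆ t}

instance {V : Type*} [DecidableEq V] (F : List (Finset V)) :
    DecidablePred (· ∈ generatedComplex F) := fun s =>
  inferInstanceAs (Decidable (∃ t ∈ F, s ⊆ t))

theorem isSimplicialComplex_generatedComplex {V : Type*} {F : List (Finset V)} (hF : F ≠ []) :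
    IsSimplicialComplex (generatedComplex F) := by
  obtain ⟨t, ht⟩ := List.exists_mem_of_ne_nil F hF
  exact ⟨⟨t, ht, Finset.empty_subset t⟩,
    fun s ⟨u, hu, hsu⟩ r hrs => ⟨u, hu, hrs.trans hsu⟩⟩

/-- Facets of representatives of the complexes on four vertices up to permutations and
Alexander duality. The Bier spheres of the first thirteen are pairwise inequivalent. -/
def facets : Fin 16 → List (Finset (Fin 4)) := ![
  [∅],
  [{0}],
  [{0}, {1}],
  [{0, 1}],
  [{0}, {1}, {2}],
  [{0, 1}, {2}],
  [{0}, {1}, {2}, {3}],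
  [{0, 1}, {0, 2}],
  [{0, 1}, {2}, {3}],
  [{0, 1}, {0, 2}, {3}],
  [{0, 1}, {2, 3}],
  [{0, 1}, {0, 2}, {1, 2}, {3}],
  [{0, 1}, {0, 2}, {0, 3}],
  [{0, 1, 2}],
  [{0, 1}, {0, 2}, {1, 2}],
  [{0, 1}, {0, 2}, {1, 3}]]

/-- The representative complexes. -/
def repComplex (r : Fin 16) : Set (Finset (Fin 4)) := generatedComplex (facets r)

instance (r : Fin 16) : DecidablePred (· ∈ repComplex r) :=
  inferInstanceAs (DecidablePred (· ∈ generatedComplex (facets r)))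

/-- The degree sequences of the Bier spheres of the first thirteen representatives; zeros come
from elements of the ground set that are not vertices. -/
def degreeTable : Fin 13 → Multiset ℕ := ![
  {0, 0, 0, 0, 3, 3, 3, 3},
  {0, 0, 0, 3, 3, 4, 4, 4},
  {0, 0, 3, 3, 4, 4, 5, 5},
  {0, 0, 4, 4, 4, 4, 4, 4},
  {0, 3, 3, 3, 5, 5, 5, 6},
  {0, 3, 4, 4, 4, 5, 5, 5},
  {3, 3, 3, 3, 6, 6, 6, 6},
  {0, 4, 4, 4, 4, 4, 5, 5},
  {3, 3, 4, 4, 5, 5, 6, 6},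
  {3, 4, 4, 4, 5, 5, 5, 6},
  {4, 4, 4, 4, 5, 5, 5, 5},
  {3, 3, 5, 5, 5, 5, 5, 5},
  {4, 4, 4, 4, 4, 4, 6, 6}]

theorem degreeSequence_bier_repComplex (j : Fin 13) :
    degreeSequence (bier (repComplex (j.castLE (by decide)))) = degreeTable j := by
  revert j
  decide +kernel

theorem degreeTable_injective : Function.Injective degreeTable := by
  decide +kernel

open Sum in
theorem combEquiv_bier_triangle_edge :
    CombEquiv (bier (repComplex 13)) (bier (repComplex 3)) :=
  ⟨[inl 2, inr 2, inr 3, inl 3].formPerm, by decide +kernel⟩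

open Sum in
theorem combEquiv_bier_cycle_edge_point :
    CombEquiv (bier (repComplex 14)) (bier (repComplex 5)) :=
  ⟨[inl 0, inr 0].formPerm * [inl 1, inr 1].formPerm * [inl 2, inr 3].formPerm,
    by decide +kernel⟩

open Sum in
theorem combEquiv_bier_path_two_edges :
    CombEquiv (bier (repComplex 15)) (bier (repComplex 10)) :=
  ⟨[inl 0, inr 0, inr 1, inr 3, inl 3].formPerm * [inl 1, inr 2].formPerm,
    by decide +kernel⟩

theorem exists_combEquiv_bier_repComplex_castLE (r : Fin 16) :
    ∃ j : Fin 13, CombEquiv (bier (repComplex r)) (bier (repComplex (j.castLE (by decide)))) := by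
  by_cases hr : r.val < 13
  · exact ⟨⟨r, hr⟩, 1, fun s => by simp⟩
  · obtain rfl | rfl | rfl : r = 13 ∨ r = 14 ∨ r = 15 := by omega
    · exact ⟨3, combEquiv_bier_triangle_edge⟩
    · exact ⟨5, combEquiv_bier_cycle_edge_point⟩
    · exact ⟨10, combEquiv_bier_path_two_edges⟩

end Representatives

/-! ### Classification up to permutations and duality -/

section Classification

/-- The bit mask of a subset of `Fin 4`. -/
def bitMask (s : Finset (Fin 4)) : ℕ := ∑ i ∈ s, 2 ^ (i : ℕ)

/-- The action of `π` on bit masks of subsets of `Fin 4`. -/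
def permuteMask (π : Equiv.Perm (Fin 4)) (m : ℕ) : ℕ :=
  (cond (m.testBit 0) (2 ^ (π 0 : ℕ)) 0 + cond (m.testBit 1) (2 ^ (π 1 : ℕ)) 0) +
    (cond (m.testBit 2) (2 ^ (π 2 : ℕ)) 0 + cond (m.testBit 3) (2 ^ (π 3 : ℕ)) 0)

theorem bitMask_lt (s : Finset (Fin 4)) : bitMask s < 16 := by
  revert s
  decide +kernel

theorem bitMask_image (π : Equiv.Perm (Fin 4)) (s : Finset (Fin 4)) :
    bitMask (s.image π) = permuteMask π (bitMask s) := by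
  revert π s
  decide +kernel

theorem bitMask_univ_sdiff (s : Finset (Fin 4)) :
    bitMask (Finset.univ \ s) = 15 - bitMask s := by
  revert s
  decide +kernel

/-- The numbers whose bit at position `bitMask s` records whether `s` is a face. -/
def repCode : Fin 16 → ℕ :=
  ![1, 3, 7, 15, 23, 31, 279, 63, 287, 319, 4383, 383, 831, 255, 127, 1343]

theorem mem_repComplex_iff (r : Fin 16) (s : Finset (Fin 4)) :
    s ∈ repComplex r ↔ (repCode r).testBit (bitMask s) = true := by
  revert r s
  decide +kernel

/-- The numbers of faces of the representatives. -/
def repFaceNumber : Fin 16 → ℕ :=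
  ![1, 2, 3, 4, 4, 5, 5, 6, 6, 7, 7, 8, 8, 8, 7, 8]

/-- For a list `k` of face indicators, ordered by bit mask: `k` is a permuted copy of a
representative or of the Alexander dual of one. The conditions on the number of faces are
redundant, but speed up the search for a representative. -/
def IsRepresented (k : List Bool) : Prop :=
  (∃ r : Fin 16, k.count true = repFaceNumber r ∧ ∃ π : Equiv.Perm (Fin 4),
    ∀ m < 16, k.getD m false = (repCode r).testBit (permuteMask π m)) ∨
  (∃ r : Fin 16, k.count true = 16 - repFaceNumber r ∧ ∃ π : Equiv.Perm (Fin 4),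
    ∀ m < 16, k.getD m false = !(repCode r).testBit (15 - permuteMask π m))

instance : DecidablePred IsRepresented := fun k => by
  unfold IsRepresented
  infer_instance

set_option synthInstance.maxSize 1000 in
theorem isRepresented_of_downward_closed :
    ∀ a b c d : Bool,
    ∀ ab ≤ (a && b), ∀ ac ≤ (a && c), ∀ ad ≤ (a && d),
    ∀ bc ≤ (b && c), ∀ bd ≤ (b && d), ∀ cd ≤ (c && d),
    ∀ abc ≤ (ab && ac && bc), ∀ abd ≤ (ab && ad && bd),
    ∀ acd ≤ (ac && ad && cd), ∀ bcd ≤ (bc && bd && cd),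
    IsRepresented [true, a, b, ab, c, ac, bc, abc, d, ad, bd, abd, cd, acd, bcd, false] := by
  decide +kernel

/-- The subsets of `Fin 4`, ordered by bit mask. -/
def facesByMask : List (Finset (Fin 4)) :=
  [∅, {0}, {1}, {0, 1}, {2}, {0, 2}, {1, 2}, {0, 1, 2},
    {3}, {0, 3}, {1, 3}, {0, 1, 3}, {2, 3}, {0, 2, 3}, {1, 2, 3}, Finset.univ]

theorem getD_facesByMask (s : Finset (Fin 4)) :
    facesByMask.getD (bitMask s) Finset.univ = s := by
  revert s
  decide +kernel

open Classical in
theorem isRepresented_of_isSimplicialComplex {K : Set (Finset (Fin 4))}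
    (hK : IsSimplicialComplex K) (huniv : Finset.univ ∉ K) :
    IsRepresented (facesByMask.map fun s => decide (s ∈ K)) := by
  have hle : ∀ s t : Finset (Fin 4), t ⊆ s → decide (s ∈ K) ≤ decide (t ∈ K) :=
    fun s t hts => Bool.le_iff_imp.2 (by simpa using fun hs => hK.2 s hs t hts)
  simp only [facesByMask, List.map_cons, List.map_nil, decide_eq_true hK.1,
    decide_eq_false huniv]
  apply isRepresented_of_downward_closed <;>
    first
    | exact le_inf (hle _ _ (by decide)) (hle _ _ (by decide))
    | exact le_inf (le_inf (hle _ _ (by decide)) (hle _ _ (by decide))) (hle _ _ (by decide))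

theorem exists_combEquiv_bier_repComplex {K : Set (Finset (Fin 4))}
    (hK : IsSimplicialComplex K) (huniv : Finset.univ ∉ K) :
    ∃ r, CombEquiv (bier K) (bier (repComplex r)) := by
  classical
  have hget : ∀ s, (facesByMask.map fun s => decide (s ∈ K)).getD (bitMask s) false =
      decide (s ∈ K) := fun s => by
    rw [← decide_eq_false huniv, List.getD_map (f := fun s => decide (s ∈ K)), getD_facesByMask]
  obtain ⟨r, -, π, h⟩ | ⟨r, -, π, h⟩ := isRepresented_of_isSimplicialComplex hK huniv
  · refine ⟨r, combEquiv_bier_of_combEquiv ⟨π, fun s => ?_⟩⟩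
    rw [mem_repComplex_iff, bitMask_image, ← h _ (bitMask_lt s), hget, decide_eq_true_eq]
  · refine ⟨r, CombEquiv.trans (combEquiv_bier_of_combEquiv ⟨π, fun s => ?_⟩)
      (combEquiv_bier_alexDual _)⟩
    have hs := h _ (bitMask_lt s)
    rw [hget, ← bitMask_image, ← bitMask_univ_sdiff] at hs
    rw [alexDual, Set.mem_ofPred_eq, mem_repComplex_iff, ← decide_eq_true_eq (p := s ∈ K), hs]
    simp

theorem univ_notMem_of_ne_univ {V : Type*} [Fintype V] {K : Set (Finset V)}
    (hK : IsSimplicialComplex K) (hne : K ≠ Set.univ) : Finset.univ ∉ K := fun h =>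
  hne (Set.eq_univ_of_forall fun s => hK.2 _ h s (Finset.subset_univ s))

theorem univ_notMem_repComplex (r : Fin 16) : Finset.univ ∉ repComplex r := by
  revert r
  decide +kernel

theorem facets_ne_nil (r : Fin 16) : facets r ≠ [] := by
  revert r
  decide +kernel

end Classification

/-- the Bier spheres of simplicial complexes on `[4]` (other than the full
simplex) fall into exactly 13 combinatorial equivalence classes. -/
theorem bier_spheres_on_four_vertices_thirteen_classes :
    ∃ Ks : Fin 13 → Set (Finset (Fin 4)),
      (∀ j, IsSimplicialComplex (Ks j) ∧ Ks j ≠ Set.univ) ∧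
      (∀ j k, CombEquiv (bier (Ks j)) (bier (Ks k)) → j = k) ∧
      (∀ K : Set (Finset (Fin 4)), IsSimplicialComplex K → K ≠ Set.univ →
        ∃ j, CombEquiv (bier K) (bier (Ks j))) := by
  refine ⟨fun j => repComplex (j.castLE (by decide)), fun j => ⟨?_, fun h => ?_⟩,
    fun j k h => degreeTable_injective ?_, fun K hK hne => ?_⟩
  · exact isSimplicialComplex_generatedComplex (facets_ne_nil _)
  · exact univ_notMem_repComplex _ (h ▸ Set.mem_univ _)
  · rw [← degreeSequence_bier_repComplex, ← degreeSequence_bier_repComplex]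
    exact h.degreeSequence_eq
  · obtain ⟨r, hr⟩ := exists_combEquiv_bier_repComplex hK (univ_notMem_of_ne_univ hK hne)
    obtain ⟨j, hj⟩ := exists_combEquiv_bier_repComplex_castLE r
    exact ⟨j, hr.trans hj⟩
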